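/- Let (X,d) be a compact metric space, T : X → X a continuous map, f : X → ℝ continuous, and fix a family {N_δ : δ > 0} ⊂ ℕ with N_δ ≥ 1 for all δ. Then the variant of the Feldman-Katok pseudo-orbit pressure in which the limsup over δ is replaced by an infimum also equals the topological pressure: lim_{ε→0} inf_{δ>0} inf_{α>0} limsup_{n→∞} (1/n) log FKPOsp_{n,ε;α,δ}(f) = P(X,T,f). -/

import Mathlib

open Filter Metric Set Topology

variable {X : Type*}

def FKChain [MetricSpace X] (T : X → X) (α δ : ℝ) (n : ℕ) (x : ℕ → X) : Prop :=
  ∃ k : ℕ, (1 - δ) * (n : ℝ) < (k : ℝ) ∧ k ≤ n ∧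
    ∃ i j : ℕ → ℕ,
      StrictMonoOn i (Set.Iio k) ∧ StrictMonoOn j (Set.Iio k) ∧
      (∀ t < k, i t < n ∧ j t < n) ∧
      (∀ t, t + 1 < k → dist (T^[j (t + 1) - j t] (x (i t))) (x (i (t + 1))) ≤ α)

def FKPO [MetricSpace X] (T : X → X) (α δ : ℝ) (N : ℕ) : Set (ℕ → X) :=
  { x | ∃ s : ℕ → ℕ, StrictMono s ∧ s 0 ≤ N ∧ (∀ i, s (i + 1) - s i ≤ N) ∧
      ∀ m n : ℕ, n < m → FKChain T α δ (s m - s n) (fun t => x (s n + t)) }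

noncomputable def FKPOsp [MetricSpace X] (T : X → X) (f : X → ℝ) (n : ℕ) (ε α δ : ℝ)
    (N : ℕ) : ℝ :=
  sInf { r : ℝ | ∃ F : Finset (ℕ → X), ↑F ⊆ FKPO T α δ N ∧
      (∀ x ∈ FKPO T α δ N, ∃ y ∈ F, ∀ i < n, dist (x i) (y i) < ε) ∧
      r = ∑ y ∈ F, Real.exp (∑ i ∈ Finset.range n, f (y i)) }

noncomputable def spanPress [MetricSpace X] (T : X → X) (f : X → ℝ) (n : ℕ) (ε : ℝ) : ℝ :=
  sInf { r : ℝ | ∃ F : Finset X,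
      (∀ x : X, ∃ y ∈ F, ∀ i < n, dist (T^[i] x) (T^[i] y) ≤ ε) ∧
      r = ∑ y ∈ F, Real.exp (∑ i ∈ Finset.range n, f (T^[i] y)) }

noncomputable def Pres [MetricSpace X] (T : X → X) (f : X → ℝ) : ℝ :=
  limsup (fun ε : ℝ => limsup (fun n : ℕ => Real.log (spanPress T f n ε) / n) atTop)
    (nhdsWithin 0 (Set.Ioi 0))

theorem orbit_mem_FKPO [MetricSpace X] (T : X → X) {α δ : ℝ} (hα : 0 < α) (hδ : 0 < δ)
    {N : ℕ} (hN : 1 ≤ N) (x : X) : (fun i => T^[i] x) ∈ FKPO T α δ N := by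
  refine ⟨id, strictMono_id, by simp, fun i => by simp; omega, fun m n hnm => ?_⟩
  have hpos : (0 : ℝ) < ((m - n : ℕ) : ℝ) := by exact_mod_cast Nat.sub_pos_of_lt hnm
  refine ⟨m - n, by simp only [id]; nlinarith, le_rfl, id, id, strictMono_id.strictMonoOn _,
    strictMono_id.strictMonoOn _, fun t ht => ⟨ht, ht⟩, fun t _ => ?_⟩
  have : T^[id (t + 1) - id t] (T^[id n + id t] x) = T^[id n + id (t + 1)] x := by
    rw [← Function.iterate_add_apply]
    congr 1
    simp only [id]
    omega
  rw [this, dist_self]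
  exact hα.le

theorem exists_subset_shadowing [MetricSpace X] {A κ : Type*} (f : X → ℝ) (val : A → ℕ → X)
    (Y : Set A) (I : Finset κ) (z : κ → ℕ → X) (n : ℕ) {ρ ω : ℝ}
    (hω : ∀ u v, dist u v ≤ ρ → f u ≤ f v + ω)
    (hc : ∀ x ∈ Y, ∃ c ∈ I, ∀ i < n, dist (val x i) (z c i) ≤ ρ) :
    ∃ F : Finset A, ↑F ⊆ Y ∧ (∀ x ∈ Y, ∃ y ∈ F, ∀ i < n, dist (val x i) (val y i) ≤ 2 * ρ) ∧
      ∑ y ∈ F, Real.exp (∑ i ∈ Finset.range n, f (val y i)) ≤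
        Real.exp (n * ω) * ∑ c ∈ I, Real.exp (∑ i ∈ Finset.range n, f (z c i)) := by
  classical
  rcases Y.eq_empty_or_nonempty with rfl | ⟨x₀, -⟩
  · refine ⟨∅, by simp, by simp, ?_⟩
    simp only [Finset.sum_empty]
    positivity
  have : Nonempty A := ⟨x₀⟩
  let J := I.filter fun c => ∃ x ∈ Y, ∀ i < n, dist (val x i) (z c i) ≤ ρ
  have hJ : ∀ c ∈ J, ∃ x ∈ Y, ∀ i < n, dist (val x i) (z c i) ≤ ρ :=
    fun c hcJ => (Finset.mem_filter.1 hcJ).2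
  choose! g hgY hg using hJ
  refine ⟨J.image g, ?_, fun x hx => ?_, ?_⟩
  · intro y hy
    obtain ⟨c, hcJ, rfl⟩ := Finset.mem_image.1 hy
    exact hgY c hcJ
  · obtain ⟨c, hcI, hxc⟩ := hc x hx
    have hcJ : c ∈ J := Finset.mem_filter.2 ⟨hcI, x, hx, hxc⟩
    refine ⟨g c, Finset.mem_image_of_mem g hcJ, fun i hi => ?_⟩
    have h₁ := hxc i hi
    have h₂ := hg c hcJ i hi
    have h₃ := dist_triangle_right (val x i) (val (g c) i) (z c i)
    linarith
  · calc ∑ y ∈ J.image g, Real.exp (∑ i ∈ Finset.range n, f (val y i))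
        ≤ ∑ c ∈ J, Real.exp (∑ i ∈ Finset.range n, f (val (g c) i)) :=
          Finset.sum_image_le_of_nonneg fun _ _ => (Real.exp_pos _).le
      _ ≤ ∑ c ∈ J, Real.exp (n * ω) * Real.exp (∑ i ∈ Finset.range n, f (z c i)) := by
          refine Finset.sum_le_sum fun c hcJ => ?_
          rw [← Real.exp_add, Real.exp_le_exp]
          calc ∑ i ∈ Finset.range n, f (val (g c) i)
              ≤ ∑ i ∈ Finset.range n, (f (z c i) + ω) :=
                Finset.sum_le_sum fun i hi => hω _ _ (hg c hcJ i (Finset.mem_range.1 hi))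
            _ = n * ω + ∑ i ∈ Finset.range n, f (z c i) := by
                rw [Finset.sum_add_distrib, Finset.sum_const, Finset.card_range, nsmul_eq_mul,
                  add_comm]
      _ ≤ ∑ c ∈ I, Real.exp (n * ω) * Real.exp (∑ i ∈ Finset.range n, f (z c i)) :=
          Finset.sum_le_sum_of_subset_of_nonneg (Finset.filter_subset _ _)
            fun _ _ _ => by positivity
      _ = _ := by rw [Finset.mul_sum]

theorem exists_pseudoOrbit_shadowing [MetricSpace X] [CompactSpace X] {T : X → X}
    (hT : Continuous T) (m : ℕ) : ∀ {ρ : ℝ}, 0 < ρ → ∃ α : ℝ, 0 < α ∧ ∀ x : ℕ → X,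
      (∀ i, i + 1 < m → dist (T (x i)) (x (i + 1)) ≤ α) →
        ∀ i < m, dist (x i) (T^[i] (x 0)) ≤ ρ := by
  induction m with
  | zero => exact fun _ => ⟨1, one_pos, by simp⟩
  | succ m ih =>
    intro ρ hρ
    obtain ⟨δ, hδ, hTδ⟩ := Metric.uniformContinuous_iff.1
      (CompactSpace.uniformContinuous_of_continuous hT) (ρ / 2) (by positivity)
    obtain ⟨α, hα, h⟩ := ih (ρ := min ρ (δ / 2)) (by positivity)
    refine ⟨min α (ρ / 2), by positivity, fun x hx i hi => ?_⟩
    have hlt : ∀ i < m, dist (x i) (T^[i] (x 0)) ≤ min ρ (δ / 2) :=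
      h x fun i hi => (hx i (by omega)).trans (min_le_left _ _)
    rcases Nat.lt_succ_iff_lt_or_eq.1 hi with hi | rfl
    · exact (hlt i hi).trans (min_le_left _ _)
    · cases i with
      | zero => simpa using hρ.le
      | succ i =>
        have h₁ := (hx i (by omega)).trans (min_le_right _ _)
        have h₂ := hTδ (lt_of_le_of_lt ((hlt i (by omega)).trans (min_le_right _ _))
          (half_lt_self hδ))
        rw [Function.iterate_succ_apply']
        have h₃ := dist_triangle_left (x (i + 1)) (T (T^[i] (x 0))) (T (x i))
        linarith

theorem StrictMonoOn.add_card_jumps_le {i : ℕ → ℕ} {k : ℕ} (hi : StrictMonoOn i (Set.Iio k))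
    (l : ℕ) (hl : l < k) :
    l + ((Finset.range l).filter fun t => i (t + 1) ≠ i t + 1).card ≤ i l := by
  induction l with
  | zero => simp
  | succ l ih =>
    have h₁ := ih (by omega)
    have h₂ : i l < i (l + 1) := hi (by simp; omega) (by simpa using hl) (Nat.lt_succ_self l)
    rw [Finset.range_add_one, Finset.filter_insert]
    split_ifs with h
    · rw [Finset.card_insert_of_notMem (by simp)]
      omega
    · omega

open Classical in
theorem FKChain.card_jumps_le [MetricSpace X] {T : X → X} {α δ : ℝ} {n : ℕ} {x : ℕ → X}
    (h : FKChain T α δ n x) :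
    (((Finset.range n).filter fun u => ¬ dist (T (x u)) (x (u + 1)) ≤ α).card : ℝ) ≤
      3 * (δ * n) + 1 := by
  obtain ⟨k, hk, hkn, i, j, hi, hj, hij, hd⟩ := h
  set B := (Finset.range n).filter fun u => ¬ dist (T (x u)) (x (u + 1)) ≤ α with hB
  suffices hBk : B.card ≤ 3 * (n - k) + 1 by
    have h₁ : (B.card : ℝ) ≤ 3 * ((n : ℝ) - k) + 1 := by
      have : (B.card : ℝ) ≤ ((3 * (n - k) + 1 : ℕ) : ℝ) := by exact_mod_cast hBk
      rwa [Nat.cast_add, Nat.cast_mul, Nat.cast_sub hkn, Nat.cast_one, Nat.cast_ofNat] at this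
    linarith
  rcases Nat.eq_zero_or_pos k with rfl | hk0
  · have : B.card ≤ n := by simpa using Finset.card_filter_le (Finset.range n) _
    omega
  have hi' := hi.add_card_jumps_le (k - 1) (by omega)
  have hj' := hj.add_card_jumps_le (k - 1) (by omega)
  have hlast := hij (k - 1) (by omega)
  set Bi := (Finset.range (k - 1)).filter fun t => i (t + 1) ≠ i t + 1
  set Bj := (Finset.range (k - 1)).filter fun t => j (t + 1) ≠ j t + 1
  set G := Finset.range (k - 1) \ (Bi ∪ Bj) with hG
  have hGcard : k - 1 ≤ G.card + (Bi.card + Bj.card) := by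
    have h₁ := Finset.le_card_sdiff (Bi ∪ Bj) (Finset.range (k - 1))
    have h₂ := Finset.card_union_le Bi Bj
    rw [← hG, Finset.card_range] at h₁
    omega
  have hGmem : ∀ t ∈ G, t + 1 < k ∧ i (t + 1) = i t + 1 ∧ j (t + 1) = j t + 1 := by
    intro t ht
    simp only [hG, Bi, Bj, Finset.mem_sdiff, Finset.mem_union, Finset.mem_filter,
      Finset.mem_range, not_or, not_and, not_not] at ht
    exact ⟨by omega, ht.2.1 ht.1, ht.2.2 ht.1⟩
  have hinj : (G.image i).card = G.card := by
    refine Finset.card_image_of_injOn fun s hs t ht hst => hi.injOn ?_ ?_ hst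
    · have := (hGmem s hs).1
      simp only [Set.mem_Iio]
      omega
    · have := (hGmem t ht).1
      simp only [Set.mem_Iio]
      omega
  have hdisj : Disjoint B (G.image i) := by
    rw [Finset.disjoint_right]
    intro u hu huB
    obtain ⟨t, ht, rfl⟩ := Finset.mem_image.1 hu
    obtain ⟨htk, hit, hjt⟩ := hGmem t ht
    have := hd t htk
    rw [hit, hjt, Nat.add_sub_cancel_left, Function.iterate_one] at this
    exact (Finset.mem_filter.1 huB).2 this
  have hsub : B ∪ G.image i ⊆ Finset.range n := by
    refine Finset.union_subset (Finset.filter_subset _ _) fun u hu => ?_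
    obtain ⟨t, ht, rfl⟩ := Finset.mem_image.1 hu
    exact Finset.mem_range.2 (hij t (by have := (hGmem t ht).1; omega)).1
  have hcard := Finset.card_le_card hsub
  rw [Finset.card_union_of_disjoint hdisj, hinj, Finset.card_range] at hcard
  omega

open Classical in
theorem card_jumps_le_of_mem_FKPO [MetricSpace X] {T : X → X} {α δ : ℝ} (hδ : 0 ≤ δ) {N : ℕ}
    {x : ℕ → X} (hx : x ∈ FKPO T α δ N) (M : ℕ) :
    (((Finset.range M).filter fun u => ¬ dist (T (x u)) (x (u + 1)) ≤ α).card : ℝ) ≤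
      3 * (δ * (M + 2 * N)) + 1 + N := by
  obtain ⟨s, hs, hs0, hsN, hchain⟩ := hx
  have hb : ∃ b, 0 < b ∧ M ≤ s b ∧ s b ≤ M + 2 * N := by
    induction M with
    | zero => exact ⟨1, one_pos, Nat.zero_le _, by have := hsN 0; simp only [zero_add] at *; omega⟩
    | succ M ih =>
      obtain ⟨b, hb0, hMb, hbM⟩ := ih
      by_cases h : M + 1 ≤ s b
      · exact ⟨b, hb0, h, by omega⟩
      · have h₁ := hsN b
        have h₂ := hs (Nat.lt_succ_self b)
        simp only [Nat.succ_eq_add_one] at h₂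
        exact ⟨b + 1, by omega, by omega, by omega⟩
  obtain ⟨b, hb0, hMb, hbM⟩ := hb
  have hcard := (hchain b 0 hb0).card_jumps_le
  set B := (Finset.range (s b - s 0)).filter
    fun u => ¬ dist (T (x (s 0 + u))) (x (s 0 + (u + 1))) ≤ α
  have hsub : ((Finset.range M).filter fun u => ¬ dist (T (x u)) (x (u + 1)) ≤ α) ⊆
      Finset.range (s 0) ∪ B.image (s 0 + ·) := by
    intro u hu
    obtain ⟨huM, hud⟩ := Finset.mem_filter.1 hu
    rw [Finset.mem_range] at huM
    rw [Finset.mem_union, Finset.mem_range]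
    refine (lt_or_ge u (s 0)).imp_right fun h => Finset.mem_image.2 ⟨u - s 0, ?_, by omega⟩
    refine Finset.mem_filter.2 ⟨Finset.mem_range.2 (by omega), ?_⟩
    rwa [← add_assoc, Nat.add_sub_cancel' h]
  have h₁ := (Finset.card_le_card hsub).trans (Finset.card_union_le _ _)
  have h₂ : (B.image (s 0 + ·)).card ≤ B.card := Finset.card_image_le
  rw [Finset.card_range] at h₁
  have h₃ : (((Finset.range M).filter fun u => ¬ dist (T (x u)) (x (u + 1)) ≤ α).card : ℝ) ≤
      N + B.card := by exact_mod_cast h₁.trans (by omega)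
  have h₄ : ((s b - s 0 : ℕ) : ℝ) ≤ M + 2 * N := by exact_mod_cast (by omega)
  have h₅ := mul_le_mul_of_nonneg_left h₄ hδ
  linarith

theorem exists_finite_net (X : Type*) [MetricSpace X] [CompactSpace X] {ρ : ℝ} (hρ : 0 < ρ) :
    ∃ K : Finset X, ∀ x : X, ∃ y ∈ K, dist x y ≤ ρ := by
  obtain ⟨t, -, ht, hcov⟩ := (isCompact_univ (X := X)).finite_cover_balls hρ
  refine ⟨ht.toFinset, fun x => ?_⟩
  obtain ⟨y, hy, hxy⟩ := Set.mem_iUnion₂.1 (hcov (Set.mem_univ x))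
  exact ⟨y, ht.mem_toFinset.2 hy, (Metric.mem_ball.1 hxy).le⟩

theorem Finset.sum_range_mul_eq_sum_sum {M : Type*} [AddCommMonoid M] (g : ℕ → M) (q m : ℕ) :
    ∑ i ∈ Finset.range (q * m), g i =
      ∑ a ∈ Finset.range q, ∑ r ∈ Finset.range m, g (a * m + r) := by
  induction q with
  | zero => simp
  | succ q ih => rw [Nat.succ_mul, Finset.sum_range_add, ih, Finset.sum_range_succ]

theorem sum_exp_filter_card_le {κ : Type*} (S : Finset κ) (g : κ → ℝ) (bad : κ → Prop)
    [DecidablePred bad] {D : ℝ} (hD : 0 ≤ D) (q : ℕ) (b : ℝ) :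
    ∑ c ∈ (Fintype.piFinset fun _ : Fin q => S) with
        ((Finset.univ.filter fun a => bad (c a)).card : ℝ) ≤ b, Real.exp (∑ a, g (c a)) ≤
      Real.exp (D * b) * (∑ s ∈ S, Real.exp (g s) * if bad s then Real.exp (-D) else 1) ^ q := by
  have hnn : ∀ s, 0 ≤ Real.exp (g s) * if bad s then Real.exp (-D) else 1 := fun s => by
    split_ifs <;> positivity
  have hpow : (∑ s ∈ S, Real.exp (g s) * if bad s then Real.exp (-D) else 1) ^ q =
      ∑ c ∈ Fintype.piFinset fun _ : Fin q => S,
        ∏ a, (Real.exp (g (c a)) * if bad (c a) then Real.exp (-D) else 1) := by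
    rw [← Finset.prod_univ_sum (fun _ : Fin q => S)
      fun _ s => Real.exp (g s) * if bad s then Real.exp (-D) else 1]
    simp
  rw [hpow, Finset.mul_sum]
  refine le_trans (Finset.sum_le_sum fun c hc => ?_) (Finset.sum_le_sum_of_subset_of_nonneg
    (Finset.filter_subset _ _) fun c _ _ =>
      mul_nonneg (Real.exp_pos _).le (Finset.prod_nonneg fun a _ => hnn (c a)))
  have hcb := (Finset.mem_filter.1 hc).2
  rw [Finset.prod_mul_distrib, ← Real.exp_sum, Finset.prod_ite, Finset.prod_const,
    Finset.prod_const_one, mul_one, ← Real.exp_nat_mul, ← Real.exp_add, ← Real.exp_add,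
    Real.exp_le_exp]
  have := mul_le_mul_of_nonneg_left hcb hD
  linarith

theorem exists_subset_of_blocks [MetricSpace X] {A κ : Type*} (f : X → ℝ) (val : A → ℕ → X)
    (Y : Set A) (S : Finset κ) (pat : κ → ℕ → X) (bad : κ → Prop) [DecidablePred bad]
    {n m q : ℕ} (hm : 0 < m) (hnq : n ≤ q * m) (hqn : q * m ≤ n + m) {ρ ω C D b : ℝ}
    (hD : 0 ≤ D) (hC : ∀ u, |f u| ≤ C) (hω : ∀ u v, dist u v ≤ ρ → f u ≤ f v + ω)
    (hc : ∀ x ∈ Y, ∃ c : Fin q → κ, (∀ a, c a ∈ S) ∧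
      ((Finset.univ.filter fun a => bad (c a)).card : ℝ) ≤ b ∧
      ∀ a : Fin q, ∀ r < m, dist (val x (a * m + r)) (pat (c a) r) ≤ ρ) :
    ∃ F : Finset A, ↑F ⊆ Y ∧ (∀ x ∈ Y, ∃ y ∈ F, ∀ i < n, dist (val x i) (val y i) ≤ 2 * ρ) ∧
      ∑ y ∈ F, Real.exp (∑ i ∈ Finset.range n, f (val y i)) ≤
        Real.exp (n * ω) * (Real.exp (m * C) * (Real.exp (D * b) *
          (∑ s ∈ S, Real.exp (∑ r ∈ Finset.range m, f (pat s r)) *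
            if bad s then Real.exp (-D) else 1) ^ q)) := by
  classical
  rcases Y.eq_empty_or_nonempty with rfl | ⟨x₀, -⟩
  · refine ⟨∅, by simp, by simp, ?_⟩
    simp only [Finset.sum_empty]
    have : ∀ s, (0 : ℝ) ≤ if bad s then Real.exp (-D) else 1 := fun s => by
      split_ifs <;> positivity
    have : 0 ≤ ∑ s ∈ S, Real.exp (∑ r ∈ Finset.range m, f (pat s r)) *
        if bad s then Real.exp (-D) else 1 :=
      Finset.sum_nonneg fun s _ => mul_nonneg (Real.exp_pos _).le (this s)
    positivity
  let z : (Fin q → κ) → ℕ → X := fun c i =>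
    if h : i / m < q then pat (c ⟨i / m, h⟩) (i % m) else val x₀ 0
  have hz : ∀ c (a : Fin q), ∀ r < m, z c (a * m + r) = pat (c a) r := by
    intro c a r hr
    have h₁ : (a * m + r) / m = a := by
      rw [Nat.mul_comm, Nat.mul_add_div hm, Nat.div_eq_of_lt hr, add_zero]
    have h₂ : (a * m + r) % m = r := by
      rw [Nat.mul_comm, Nat.mul_add_mod, Nat.mod_eq_of_lt hr]
    simp only [z, h₁, h₂, a.2, dif_pos]
  obtain ⟨F, hFY, hF, hsum⟩ := exists_subset_shadowing f val Y
    ((Fintype.piFinset fun _ : Fin q => S).filter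
      fun c => ((Finset.univ.filter fun a => bad (c a)).card : ℝ) ≤ b) z n hω (by
    intro x hx
    obtain ⟨c, hcS, hcb, hcx⟩ := hc x hx
    refine ⟨c, Finset.mem_filter.2 ⟨Fintype.mem_piFinset.2 hcS, hcb⟩, fun i hi => ?_⟩
    have hq : i / m < q := (Nat.div_lt_iff_lt_mul hm).2 (hi.trans_le hnq)
    have h₁ := hcx ⟨i / m, hq⟩ (i % m) (Nat.mod_lt _ hm)
    rwa [← hz c ⟨i / m, hq⟩ (i % m) (Nat.mod_lt _ hm), Nat.div_add_mod'] at h₁)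
  refine ⟨F, hFY, hF, hsum.trans (mul_le_mul_of_nonneg_left ?_ (Real.exp_pos _).le)⟩
  refine le_trans ?_ (mul_le_mul_of_nonneg_left (sum_exp_filter_card_le S
    (fun s => ∑ r ∈ Finset.range m, f (pat s r)) bad hD q b) (Real.exp_pos _).le)
  rw [Finset.mul_sum]
  refine Finset.sum_le_sum fun c _ => ?_
  rw [← Real.exp_add, Real.exp_le_exp]
  have hblocks : ∑ a, ∑ r ∈ Finset.range m, f (pat (c a) r) =
      ∑ i ∈ Finset.range (q * m), f (z c i) := by
    rw [Finset.sum_range_mul_eq_sum_sum, Finset.sum_range]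
    exact Finset.sum_congr rfl fun a _ => Finset.sum_congr rfl fun r hr => by
      rw [hz c a r (Finset.mem_range.1 hr)]
  have hC0 : 0 ≤ C := (abs_nonneg _).trans (hC (val x₀ 0))
  have htail : -(m * C) ≤ ∑ i ∈ Finset.range (q * m - n), f (z c (n + i)) := by
    calc -(m * C) ≤ ∑ i ∈ Finset.range (q * m - n), (-C) := by
          rw [Finset.sum_const, Finset.card_range, nsmul_eq_mul]
          have : ((q * m - n : ℕ) : ℝ) ≤ m := by exact_mod_cast (by omega)
          nlinarith
      _ ≤ _ := Finset.sum_le_sum fun i _ => (abs_le.1 (hC _)).1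
  have hsplit := Finset.sum_range_add (fun i => f (z c i)) n (q * m - n)
  rw [Nat.add_sub_cancel' hnq] at hsplit
  rw [hblocks, hsplit]
  linarith

theorem exists_spanning_sum_le [MetricSpace X] [CompactSpace X] [Nonempty X] {A : Type*}
    {f : X → ℝ} {C : ℝ} (hC : ∀ u, |f u| ≤ C) (val : A → ℕ → X) (Y : Set A) {ρ : ℝ}
    (hρ : 0 < ρ) : ∃ R : ℝ, ∀ n : ℕ, ∃ F : Finset A, ↑F ⊆ Y ∧
      (∀ x ∈ Y, ∃ y ∈ F, ∀ i < n, dist (val x i) (val y i) ≤ ρ) ∧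
      ∑ y ∈ F, Real.exp (∑ i ∈ Finset.range n, f (val y i)) ≤ Real.exp (n * R) := by
  obtain ⟨K, hK⟩ := exists_finite_net X (half_pos hρ)
  choose g hgK hg using hK
  have x₀ : X := Classical.arbitrary X
  have hKpos : (0 : ℝ) < K.card := by exact_mod_cast Finset.card_pos.2 ⟨g x₀, hgK x₀⟩
  refine ⟨2 * C + (C + Real.log K.card), fun n => ?_⟩
  let z : (Fin n → X) → ℕ → X := fun c i => if h : i < n then c ⟨i, h⟩ else x₀
  obtain ⟨F, hFY, hF, hsum⟩ := exists_subset_shadowing f val Y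
    (Fintype.piFinset fun _ : Fin n => K) z n (ρ := ρ / 2) (ω := 2 * C)
    (fun u v _ => by
      have h₁ := abs_le.1 (hC u)
      have h₂ := abs_le.1 (hC v)
      linarith)
    (fun x _ => ⟨fun i => g (val x i), Fintype.mem_piFinset.2 fun i => hgK _, fun i hi => by
      simpa only [z, hi, dif_pos] using hg (val x i)⟩)
  refine ⟨F, hFY, by simpa only [mul_div_cancel₀ ρ (two_ne_zero' ℝ)] using hF, hsum.trans ?_⟩
  rw [mul_add, Real.exp_add]
  refine mul_le_mul_of_nonneg_left ?_ (Real.exp_pos _).le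
  calc ∑ c ∈ Fintype.piFinset fun _ : Fin n => K, Real.exp (∑ i ∈ Finset.range n, f (z c i))
      ≤ ∑ c ∈ Fintype.piFinset fun _ : Fin n => K, Real.exp (n * C) := by
        refine Finset.sum_le_sum fun c _ => Real.exp_le_exp.2 ?_
        calc ∑ i ∈ Finset.range n, f (z c i) ≤ ∑ i ∈ Finset.range n, C :=
              Finset.sum_le_sum fun i _ => (abs_le.1 (hC _)).2
          _ = n * C := by rw [Finset.sum_const, Finset.card_range, nsmul_eq_mul]
    _ = Real.exp (n * (C + Real.log K.card)) := by
        rw [Finset.sum_const, Fintype.card_piFinset_const, nsmul_eq_mul, mul_add, Real.exp_add,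
          Real.exp_nat_mul (Real.log _), Real.exp_log hKpos]
        push_cast
        ring

theorem FKPOsp_le [MetricSpace X] {T : X → X} {f : X → ℝ} {n : ℕ} {ε α δ : ℝ} {N : ℕ}
    {F : Finset (ℕ → X)} (hF : ↑F ⊆ FKPO T α δ N)
    (hspan : ∀ x ∈ FKPO T α δ N, ∃ y ∈ F, ∀ i < n, dist (x i) (y i) < ε) :
    FKPOsp T f n ε α δ N ≤ ∑ y ∈ F, Real.exp (∑ i ∈ Finset.range n, f (y i)) := by
  refine csInf_le ⟨0, ?_⟩ ⟨F, hF, hspan, rfl⟩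
  rintro r ⟨F, -, -, rfl⟩
  positivity

theorem spanPress_le [MetricSpace X] {T : X → X} {f : X → ℝ} {n : ℕ} {ε : ℝ} {F : Finset X}
    (hspan : ∀ x : X, ∃ y ∈ F, ∀ i < n, dist (T^[i] x) (T^[i] y) ≤ ε) :
    spanPress T f n ε ≤ ∑ y ∈ F, Real.exp (∑ i ∈ Finset.range n, f (T^[i] y)) := by
  refine csInf_le ⟨0, ?_⟩ ⟨F, hspan, rfl⟩
  rintro r ⟨F, -, rfl⟩
  positivity

theorem exp_le_sum_exp [MetricSpace X] {A : Type*} {f : X → ℝ} {C : ℝ} (hC : ∀ u, |f u| ≤ C)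
    (val : A → ℕ → X) {F : Finset A} (hF : F.Nonempty) (n : ℕ) :
    Real.exp (n * -C) ≤ ∑ y ∈ F, Real.exp (∑ i ∈ Finset.range n, f (val y i)) := by
  obtain ⟨y, hy⟩ := hF
  refine le_trans (Real.exp_le_exp.2 ?_) (Finset.single_le_sum
    (f := fun y => Real.exp (∑ i ∈ Finset.range n, f (val y i)))
    (fun _ _ => (Real.exp_pos _).le) hy)
  calc (n : ℝ) * -C = ∑ i ∈ Finset.range n, -C := by
        rw [Finset.sum_const, Finset.card_range, nsmul_eq_mul]
    _ ≤ _ := Finset.sum_le_sum fun i _ => (abs_le.1 (hC _)).1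

section Bounds

variable [MetricSpace X] [CompactSpace X] [Nonempty X] {T : X → X} {f : X → ℝ} {C : ℝ}

theorem exp_le_FKPOsp (hC : ∀ u, |f u| ≤ C) {ε α δ : ℝ} (hε : 0 < ε) (hα : 0 < α) (hδ : 0 < δ)
    {N : ℕ} (hN : 1 ≤ N) (n : ℕ) : Real.exp (n * -C) ≤ FKPOsp T f n ε α δ N := by
  obtain ⟨R, hR⟩ := exists_spanning_sum_le hC id (FKPO T α δ N) (half_pos hε)
  obtain ⟨F, hF, hspan, -⟩ := hR n
  refine le_csInf ⟨_, F, hF, fun x hx => ?_, rfl⟩ ?_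
  · obtain ⟨y, hy, hxy⟩ := hspan x hx
    exact ⟨y, hy, fun i hi => (hxy i hi).trans_lt (half_lt_self hε)⟩
  · rintro r ⟨F, -, hspan, rfl⟩
    obtain ⟨y, hy, -⟩ := hspan _ (orbit_mem_FKPO T hα hδ hN (Classical.arbitrary X))
    exact exp_le_sum_exp hC id ⟨y, hy⟩ n

theorem exists_FKPOsp_le_exp (hC : ∀ u, |f u| ≤ C) {ε : ℝ} (hε : 0 < ε) (α δ : ℝ) (N : ℕ) :
    ∃ R : ℝ, ∀ n : ℕ, FKPOsp T f n ε α δ N ≤ Real.exp (n * R) := by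
  obtain ⟨R, hR⟩ := exists_spanning_sum_le hC id (FKPO T α δ N) (half_pos hε)
  refine ⟨R, fun n => ?_⟩
  obtain ⟨F, hF, hspan, hsum⟩ := hR n
  refine (FKPOsp_le hF fun x hx => ?_).trans hsum
  obtain ⟨y, hy, hxy⟩ := hspan x hx
  exact ⟨y, hy, fun i hi => (hxy i hi).trans_lt (half_lt_self hε)⟩

theorem exp_le_spanPress (hC : ∀ u, |f u| ≤ C) {ε : ℝ} (hε : 0 < ε) (n : ℕ) :
    Real.exp (n * -C) ≤ spanPress T f n ε := by
  obtain ⟨R, hR⟩ := exists_spanning_sum_le hC (fun x i => T^[i] x) Set.univ hε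
  obtain ⟨F, -, hspan, -⟩ := hR n
  refine le_csInf ⟨_, F, fun x => hspan x (Set.mem_univ x), rfl⟩ ?_
  rintro r ⟨F, hspan, rfl⟩
  obtain ⟨y, hy, -⟩ := hspan (Classical.arbitrary X)
  exact exp_le_sum_exp hC (fun x i => T^[i] x) ⟨y, hy⟩ n

theorem exists_spanPress_le_exp (hC : ∀ u, |f u| ≤ C) {ε : ℝ} (hε : 0 < ε) :
    ∃ R : ℝ, ∀ n : ℕ, spanPress T f n ε ≤ Real.exp (n * R) := by
  obtain ⟨R, hR⟩ := exists_spanning_sum_le hC (fun x i => T^[i] x) Set.univ hε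
  refine ⟨R, fun n => ?_⟩
  obtain ⟨F, -, hspan, hsum⟩ := hR n
  exact (spanPress_le fun x => hspan x (Set.mem_univ x)).trans hsum

theorem exists_spanning_sum_lt_of_spanPress_lt (hC : ∀ u, |f u| ≤ C) {ε r : ℝ} (hε : 0 < ε)
    {n : ℕ} (h : spanPress T f n ε < r) : ∃ F : Finset X,
      (∀ x : X, ∃ y ∈ F, ∀ i < n, dist (T^[i] x) (T^[i] y) ≤ ε) ∧
      ∑ y ∈ F, Real.exp (∑ i ∈ Finset.range n, f (T^[i] y)) < r := by
  obtain ⟨R, hR⟩ := exists_spanning_sum_le hC (fun x i => T^[i] x) Set.univ hε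
  obtain ⟨F, -, hspan, -⟩ := hR n
  obtain ⟨_, ⟨F, hF, rfl⟩, hlt⟩ :=
    exists_lt_of_csInf_lt (by exact ⟨_, F, fun x => hspan x (Set.mem_univ x), rfl⟩) h
  exact ⟨F, hF, hlt⟩

theorem spanPress_le_exp_mul_FKPOsp (hC : ∀ u, |f u| ≤ C) {ε α δ : ℝ} (hε : 0 < ε)
    (hα : 0 < α) (hδ : 0 < δ) {N : ℕ} (hN : 1 ≤ N) {ω : ℝ}
    (hω : ∀ u v, dist u v ≤ ε → f u ≤ f v + ω) (n : ℕ) :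
    spanPress T f n (2 * ε) ≤ Real.exp (n * ω) * FKPOsp T f n ε α δ N := by
  obtain ⟨R, hR⟩ := exists_spanning_sum_le hC id (FKPO T α δ N) (half_pos hε)
  obtain ⟨F, hF, hspan, -⟩ := hR n
  rw [← div_le_iff₀' (Real.exp_pos _)]
  refine le_csInf ⟨_, F, hF, fun x hx => ?_, rfl⟩ ?_
  · obtain ⟨y, hy, hxy⟩ := hspan x hx
    exact ⟨y, hy, fun i hi => (hxy i hi).trans_lt (half_lt_self hε)⟩
  · rintro r ⟨F, -, hspan, rfl⟩
    rw [div_le_iff₀' (Real.exp_pos _)]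
    obtain ⟨G, -, hG, hsum⟩ := exists_subset_shadowing f (fun x i => T^[i] x) Set.univ F id n hω
      fun x _ => by
        obtain ⟨y, hy, hxy⟩ := hspan _ (orbit_mem_FKPO T hα hδ hN x)
        exact ⟨y, hy, fun i hi => (hxy i hi).le⟩
    exact (spanPress_le fun x => hG x (Set.mem_univ x)).trans hsum

end Bounds

theorem FKPOsp_le_of_blocks [MetricSpace X] [Nonempty X] {T : X → X} {f : X → ℝ} {C : ℝ}
    (hC : ∀ u, |f u| ≤ C) {ε ρ : ℝ} (hρε : 2 * (2 * ρ) < ε)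
    {ω : ℝ} (hω : ∀ u v, dist u v ≤ 2 * ρ → f u ≤ f v + ω) {m : ℕ} (hm : 0 < m) {F K : Finset X}
    (hF : ∀ x : X, ∃ y ∈ F, ∀ i < m, dist (T^[i] x) (T^[i] y) ≤ ρ)
    (hK : ∀ x : X, ∃ y ∈ K, dist x y ≤ 2 * ρ) {α : ℝ}
    (hα : ∀ x : ℕ → X, (∀ i, i + 1 < m → dist (T (x i)) (x (i + 1)) ≤ α) →
      ∀ i < m, dist (x i) (T^[i] (x 0)) ≤ ρ)
    {S D : ℝ} (hD : 0 ≤ D) (hFS : ∑ y ∈ F, Real.exp (∑ i ∈ Finset.range m, f (T^[i] y)) ≤ S)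
    (hKS : (K.card : ℝ) ^ m * (Real.exp (m * C) * Real.exp (-D)) ≤ S)
    {δ : ℝ} (hδ : 0 ≤ δ) (N n q : ℕ) (hnq : n ≤ q * m) (hqn : q * m ≤ n + m) :
    FKPOsp T f n ε α δ N ≤ Real.exp (n * ω) * (Real.exp (m * C) *
      (Real.exp (D * (3 * (δ * ((q * m : ℕ) + 2 * N)) + 1 + N)) * (2 * S) ^ q)) := by
  classical
  have x₀ : X := Classical.arbitrary X
  choose g hgK hg using hK
  choose p hpF hp using hF
  let symb : Finset (X ⊕ (Fin m → X)) := F.disjSum (Fintype.piFinset fun _ => K)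
  let pat : X ⊕ (Fin m → X) → ℕ → X := Sum.elim (fun y r => T^[r] y)
    fun w r => if h : r < m then w ⟨r, h⟩ else x₀
  obtain ⟨E, hE, hspan, hsum⟩ := exists_subset_of_blocks f id (FKPO T α δ N) symb pat
    (fun s => s.isRight) hm hnq hqn hD hC hω
    (b := 3 * (δ * ((q * m : ℕ) + 2 * N)) + 1 + N) (by
    intro x hx
    let good : Fin q → Prop := fun a =>
      ∀ r, r + 1 < m → dist (T (x (a * m + r))) (x (a * m + (r + 1))) ≤ α
    let c : Fin q → X ⊕ (Fin m → X) := fun a =>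
      if good a then Sum.inl (p (x (a * m))) else Sum.inr fun r => g (x (a * m + r))
    refine ⟨c, fun a => ?_, ?_, fun a r hr => ?_⟩
    · by_cases h : good a
      · simp only [c, h, if_true, symb, Finset.inl_mem_disjSum]
        exact hpF _
      · simp only [c, h, if_false, symb, Finset.inr_mem_disjSum, Fintype.mem_piFinset]
        exact fun r => hgK _
    · refine le_trans ?_ (card_jumps_le_of_mem_FKPO hδ hx (q * m))
      rw [Nat.cast_le]
      have hjump : ∀ a, (c a).isRight = true →
          ∃ r, r + 1 < m ∧ ¬ dist (T (x (a * m + r))) (x (a * m + (r + 1))) ≤ α := by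
        intro a ha
        by_contra! hcon
        have hgood : good a := hcon
        simp [c, hgood] at ha
      choose! j hjm hj using hjump
      refine Finset.card_le_card_of_injOn (fun a => a * m + j a) (fun a ha => ?_)
        fun a ha b hb hab => ?_
      · have ha' := (Finset.mem_filter.1 (Finset.mem_coe.1 ha)).2
        have h₁ := hjm a ha'
        have h₂ : (a + 1) * m ≤ q * m := Nat.mul_le_mul_right m a.2
        refine Finset.mem_coe.2 (Finset.mem_filter.2 ⟨Finset.mem_range.2 ?_, hj a ha'⟩)
        rw [Nat.succ_mul] at h₂
        change a * m + j a < q * m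
        omega
      · have ha' := hjm a (Finset.mem_filter.1 (Finset.mem_coe.1 ha)).2
        have hb' := hjm b (Finset.mem_filter.1 (Finset.mem_coe.1 hb)).2
        have hdiv := congrArg (· / m) hab
        simp only [Nat.mul_comm _ m, Nat.mul_add_div hm, Nat.div_eq_of_lt (Nat.lt_of_succ_lt ha'),
          Nat.div_eq_of_lt (Nat.lt_of_succ_lt hb'), add_zero] at hdiv
        exact Fin.ext hdiv
    · by_cases h : good a
      · simp only [c, h, if_true, pat, Sum.elim_inl, id]
        have h₁ := hα (fun r => x (a * m + r)) h r hr
        have h₂ := hp (x (a * m)) r hr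
        have h₃ := dist_triangle (x (a * m + r)) (T^[r] (x (a * m))) (T^[r] (p (x (a * m))))
        rw [add_zero] at h₁
        linarith
      · simp only [c, h, if_false, pat, Sum.elim_inr, id, hr, dif_pos]
        exact hg _)
  refine (FKPOsp_le hE fun x hx => ?_).trans (hsum.trans ?_)
  · obtain ⟨y, hy, hxy⟩ := hspan x hx
    exact ⟨y, hy, fun i hi => (hxy i hi).trans_lt hρε⟩
  · have hword : ∀ w : Fin m → X,
        Real.exp (∑ r ∈ Finset.range m, f (pat (Sum.inr w) r)) ≤ Real.exp (m * C) := by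
      intro w
      refine Real.exp_le_exp.2 ?_
      calc ∑ r ∈ Finset.range m, f (pat (Sum.inr w) r) ≤ ∑ r ∈ Finset.range m, C :=
            Finset.sum_le_sum fun r _ => (abs_le.1 (hC _)).2
        _ = m * C := by rw [Finset.sum_const, Finset.card_range, nsmul_eq_mul]
    have htotal : ∑ s ∈ symb, Real.exp (∑ r ∈ Finset.range m, f (pat s r)) *
        (if s.isRight = true then Real.exp (-D) else 1) ≤ 2 * S := by
      rw [Finset.sum_disjSum, two_mul]
      refine add_le_add (le_trans (le_of_eq ?_) hFS) (le_trans ?_ hKS)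
      · exact Finset.sum_congr rfl fun y _ => by simp [pat]
      · calc _ ≤ ∑ w ∈ Fintype.piFinset fun _ : Fin m => K,
              Real.exp (m * C) * Real.exp (-D) := Finset.sum_le_sum fun w _ => by
                simpa only [Sum.isRight_inr, if_true] using
                  mul_le_mul_of_nonneg_right (hword w) (Real.exp_pos _).le
          _ = _ := by
            rw [Finset.sum_const, Fintype.card_piFinset_const, nsmul_eq_mul, Nat.cast_pow]
    have hnn : 0 ≤ ∑ s ∈ symb, Real.exp (∑ r ∈ Finset.range m, f (pat s r)) *
        (if s.isRight = true then Real.exp (-D) else 1) :=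
      Finset.sum_nonneg fun s _ => mul_nonneg (Real.exp_pos _).le (by split_ifs <;> positivity)
    gcongr

theorem eventually_le_log_div {u : ℕ → ℝ} {a : ℝ} (h : ∀ n : ℕ, Real.exp (n * a) ≤ u n) :
    ∀ᶠ n : ℕ in atTop, a ≤ Real.log (u n) / n := by
  filter_upwards [eventually_gt_atTop 0] with n hn
  rw [le_div_iff₀ (by exact_mod_cast hn), mul_comm,
    Real.le_log_iff_exp_le ((Real.exp_pos _).trans_le (h n))]
  exact h n

theorem eventually_log_div_le {u : ℕ → ℝ} {b : ℝ} (hu : ∀ n, 0 < u n)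
    (h : ∀ n : ℕ, u n ≤ Real.exp (n * b)) : ∀ᶠ n : ℕ in atTop, Real.log (u n) / n ≤ b := by
  filter_upwards [eventually_gt_atTop 0] with n hn
  rw [div_le_iff₀ (by exact_mod_cast hn), mul_comm b, Real.log_le_iff_le_exp (hu n)]
  exact h n

theorem le_limsup_log_div {u : ℕ → ℝ} {a b : ℝ} (ha : ∀ n : ℕ, Real.exp (n * a) ≤ u n)
    (hb : ∀ n : ℕ, u n ≤ Real.exp (n * b)) :
    a ≤ limsup (fun n : ℕ => Real.log (u n) / n) atTop :=
  le_limsup_of_frequently_le (eventually_le_log_div ha).frequently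
    (isBoundedUnder_of_eventually_le
      (eventually_log_div_le (fun n => (Real.exp_pos _).trans_le (ha n)) hb))

theorem eventually_lt_of_limsup_log_div_lt {u : ℕ → ℝ} {b r : ℝ} (hu : ∀ n, 0 < u n)
    (hb : ∀ n : ℕ, u n ≤ Real.exp (n * b))
    (h : limsup (fun n : ℕ => Real.log (u n) / n) atTop < r) :
    ∀ᶠ n : ℕ in atTop, u n < Real.exp (n * r) := by
  filter_upwards [eventually_gt_atTop 0, eventually_lt_of_limsup_lt h
    (isBoundedUnder_of_eventually_le (eventually_log_div_le hu hb))] with n hn hlt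
  rwa [div_lt_iff₀ (by exact_mod_cast hn), mul_comm r, Real.log_lt_iff_lt_exp (hu n)] at hlt

theorem limsup_log_div_le {u : ℕ → ℝ} {a r : ℝ} (ha : ∀ n : ℕ, Real.exp (n * a) ≤ u n)
    (h : ∀ᶠ n : ℕ in atTop, u n ≤ Real.exp (n * r)) :
    limsup (fun n : ℕ => Real.log (u n) / n) atTop ≤ r := by
  refine limsup_le_of_le
    (isBoundedUnder_of_eventually_ge (eventually_le_log_div ha)).isCoboundedUnder_flip ?_
  filter_upwards [eventually_gt_atTop 0, h] with n hn hle
  rwa [div_le_iff₀ (by exact_mod_cast hn), mul_comm r,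
    Real.log_le_iff_le_exp ((Real.exp_pos _).trans_le (ha n))]

section Rates

variable [MetricSpace X] [CompactSpace X] [Nonempty X] {T : X → X} {f : X → ℝ} {C : ℝ}

theorem limsup_spanPress_le (hC : ∀ u, |f u| ≤ C) {ε α δ : ℝ} (hε : 0 < ε)
    (hα : 0 < α) (hδ : 0 < δ) {N : ℕ} (hN : 1 ≤ N) {ω : ℝ}
    (hω : ∀ u v, dist u v ≤ ε → f u ≤ f v + ω) :
    limsup (fun n : ℕ => Real.log (spanPress T f n (2 * ε)) / n) atTop ≤
      limsup (fun n : ℕ => Real.log (FKPOsp T f n ε α δ N) / n) atTop + ω := by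
  obtain ⟨R, hR⟩ := exists_FKPOsp_le_exp (T := T) hC hε α δ N
  refine le_of_forall_pos_le_add fun η hη => limsup_log_div_le
    (exp_le_spanPress hC (by positivity)) ?_
  filter_upwards [eventually_lt_of_limsup_log_div_lt
    (fun n => (Real.exp_pos _).trans_le (exp_le_FKPOsp hC hε hα hδ hN n)) hR
    (lt_add_of_pos_right _ hη)] with n hn
  refine (spanPress_le_exp_mul_FKPOsp hC hε hα hδ hN hω n).trans
    ((mul_le_mul_of_nonneg_left hn.le (Real.exp_pos _).le).trans_eq ?_)
  rw [← Real.exp_add]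
  ring_nf

theorem exists_limsup_FKPOsp_le (hT : Continuous T) (hC : ∀ u, |f u| ≤ C) {N : ℝ → ℕ}
    (hN : ∀ δ, 0 < δ → 1 ≤ N δ) {ε ρ : ℝ} (hρ : 0 < ρ) (hρε : 2 * (2 * ρ) < ε)
    {ω : ℝ} (hω : ∀ u v, dist u v ≤ 2 * ρ → f u ≤ f v + ω) {η : ℝ} (hη : 0 < η) :
    ∃ δ : ℝ, 0 < δ ∧ ∃ α : ℝ, 0 < α ∧
      limsup (fun n : ℕ => Real.log (FKPOsp T f n ε α δ (N δ)) / n) atTop ≤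
        limsup (fun n : ℕ => Real.log (spanPress T f n ρ) / n) atTop + ω + 4 * η := by
  set a := limsup (fun n : ℕ => Real.log (spanPress T f n ρ) / n) atTop + η with ha
  obtain ⟨R, hR⟩ := exists_spanPress_le_exp (T := T) hC hρ
  obtain ⟨m, ⟨hmspan, hm⟩, hmη⟩ := ((eventually_lt_of_limsup_log_div_lt
    (fun n => (Real.exp_pos _).trans_le (exp_le_spanPress hC hρ n)) hR
    (lt_add_of_pos_right _ hη)).and (eventually_gt_atTop 0)
    |>.and (tendsto_natCast_atTop_atTop.eventually_ge_atTop (Real.log 2 / η))).exists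
  rw [← ha] at hmspan
  have hm0 : (0 : ℝ) < m := by exact_mod_cast hm
  have hlog2 : Real.log 2 / m ≤ η := by
    rw [div_le_iff₀ hη] at hmη
    rwa [div_le_iff₀ hm0, mul_comm]
  obtain ⟨F, hF, hFS⟩ := exists_spanning_sum_lt_of_spanPress_lt hC hρ hmspan
  obtain ⟨K, hK⟩ := exists_finite_net X (ρ := 2 * ρ) (by positivity)
  obtain ⟨α, hα, hshadow⟩ := exists_pseudoOrbit_shadowing hT m hρ
  have hKpos : (0 : ℝ) < K.card := by
    obtain ⟨y, hy, -⟩ := hK (Classical.arbitrary X)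
    exact_mod_cast Finset.card_pos.2 ⟨y, hy⟩
  obtain ⟨D, hD, hDS⟩ : ∃ D : ℝ, 0 ≤ D ∧ m * Real.log K.card + m * C - m * a ≤ D :=
    ⟨max 0 (m * Real.log K.card + m * C - m * a), le_max_left _ _, le_max_right _ _⟩
  have hKS : (K.card : ℝ) ^ m * (Real.exp (m * C) * Real.exp (-D)) ≤ Real.exp (m * a) := by
    have : (K.card : ℝ) ^ m = Real.exp (m * Real.log K.card) := by
      rw [Real.exp_nat_mul, Real.exp_log hKpos]
    rw [this, ← Real.exp_add, ← Real.exp_add, Real.exp_le_exp]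
    linarith
  let δ := η / (3 * D + 1)
  have hδ : 0 < δ := by positivity
  have hδη : 3 * D * δ ≤ η := by
    have : δ * (3 * D + 1) = η := div_mul_cancel₀ _ (by positivity)
    linarith
  refine ⟨δ, hδ, α, hα, limsup_log_div_le
    (exp_le_FKPOsp hC (by linarith) hα hδ (hN δ hδ)) ?_⟩
  set M : ℝ := m * C + D * (3 * (δ * (m + 2 * N δ)) + 1 + N δ) + Real.log 2 + m * |a| with hM
  filter_upwards [tendsto_natCast_atTop_atTop.eventually_ge_atTop (M / η)] with n hn
  rw [div_le_iff₀ hη] at hn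
  obtain ⟨q, hnq, hqn⟩ : ∃ q, n ≤ q * m ∧ q * m ≤ n + m := by
    refine ⟨n / m + 1, ?_, ?_⟩
    · rw [Nat.succ_mul]
      have h₁ := Nat.div_add_mod' n m
      have h₂ := Nat.mod_lt n hm
      omega
    · rw [Nat.succ_mul]
      exact Nat.add_le_add_right (Nat.div_mul_le_self n m) m
  refine (FKPOsp_le_of_blocks hC hρε hω hm hF hK hshadow hD hFS.le hKS hδ.le (N δ) n q
    hnq hqn).trans ?_
  have hpow : (2 * Real.exp (m * a)) ^ q = Real.exp (q * (Real.log 2 + m * a)) := by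
    rw [Real.exp_nat_mul _ q, Real.exp_add (Real.log 2), Real.exp_log two_pos]
  rw [hpow, ← Real.exp_add, ← Real.exp_add, ← Real.exp_add, Real.exp_le_exp]
  have hnq' : (n : ℝ) ≤ q * m := by exact_mod_cast hnq
  have hqn' : (q : ℝ) * m ≤ n + m := by exact_mod_cast hqn
  have h₁ : D * (3 * (δ * ((q * m : ℕ) + 2 * N δ)) + 1 + N δ) ≤
      n * η + D * (3 * (δ * (m + 2 * N δ)) + 1 + N δ) := by
    have h : 3 * D * δ * (q * m) ≤ 3 * D * δ * (n + m) :=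
      mul_le_mul_of_nonneg_left hqn' (by positivity)
    have h' := mul_le_mul_of_nonneg_right hδη (Nat.cast_nonneg (α := ℝ) n)
    push_cast
    linarith
  have h₂ : q * Real.log 2 ≤ n * η + Real.log 2 := by
    have hq : (q : ℝ) ≤ n / m + 1 := by
      rw [← sub_nonneg]
      have : (n : ℝ) / m + 1 - q = (n + m - q * m) / m := by field_simp
      rw [this]
      exact div_nonneg (by linarith) hm0.le
    have h := mul_le_mul_of_nonneg_right hq (Real.log_nonneg one_le_two)
    have h' := mul_le_mul_of_nonneg_left hlog2 (Nat.cast_nonneg (α := ℝ) n)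
    have : ((n : ℝ) / m + 1) * Real.log 2 = n * (Real.log 2 / m) + Real.log 2 := by ring
    linarith
  have h₃ : q * (m * a) ≤ n * a + m * |a| := by
    have h : ((q : ℝ) * m - n) * a ≤ m * |a| :=
      (mul_le_mul_of_nonneg_left (le_abs_self a) (by linarith)).trans
        (mul_le_mul_of_nonneg_right (by linarith) (abs_nonneg a))
    linarith
  have ha' : limsup (fun n : ℕ => Real.log (spanPress T f n ρ) / n) atTop + ω + 4 * η =
      a + ω + 3 * η := by
    rw [ha]
    ring
  rw [ha']
  linarith

end Rates

theorem Real.sInf_eq_of_forall_add_mem {P Q : Set ℝ} (hP : BddBelow P) (hQ : BddBelow Q)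
    (hPQ : ∀ a ∈ P, ∀ η > 0, a + η ∈ Q) (hQP : ∀ a ∈ Q, ∀ η > 0, a + η ∈ P) :
    sInf P = sInf Q := by
  rcases P.eq_empty_or_nonempty with rfl | hPn
  · rcases Q.eq_empty_or_nonempty with rfl | ⟨a, ha⟩
    · rfl
    · exact (hQP a ha 1 one_pos).elim
  · obtain ⟨a, ha⟩ := hPn
    refine le_antisymm (le_csInf ⟨_, hPQ a ha 1 one_pos⟩ fun b hb => ?_)
      (le_csInf ⟨a, ha⟩ fun b hb => ?_)
    · exact le_of_forall_pos_le_add fun η hη => csInf_le hP (hQP b hb η hη)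
    · exact le_of_forall_pos_le_add fun η hη => csInf_le hQ (hPQ b hb η hη)

theorem eventually_comp_div_nhdsGT_zero {p : ℝ → Prop} (h : ∀ᶠ ε in 𝓝[>] (0 : ℝ), p ε) {c : ℝ}
    (hc : 0 < c) : ∀ᶠ ε in 𝓝[>] (0 : ℝ), p (ε / c) := by
  refine Tendsto.eventually (tendsto_nhdsWithin_iff.2 ⟨?_, ?_⟩) h
  · have : Tendsto (fun ε : ℝ => ε / c) (𝓝 0) (𝓝 (0 / c)) := tendsto_id.div_const c
    rw [zero_div] at this
    exact this.mono_left nhdsWithin_le_nhds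
  · filter_upwards [self_mem_nhdsWithin] with ε hε
    exact div_pos hε hc

theorem limsup_sInf_FKPOsp_eq_Pres_of_nonempty [MetricSpace X] [CompactSpace X] [Nonempty X]
    {T : X → X} (hT : Continuous T) {f : X → ℝ} (hf : Continuous f) {N : ℝ → ℕ}
    (hN : ∀ δ : ℝ, 0 < δ → 1 ≤ N δ) :
    limsup (fun ε : ℝ =>
        sInf { r : ℝ | ∃ δ : ℝ, 0 < δ ∧ ∃ α : ℝ, 0 < α ∧
            r = limsup (fun n : ℕ => Real.log (FKPOsp T f n ε α δ (N δ)) / n) atTop })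
      (nhdsWithin 0 (Set.Ioi 0)) = Pres T f := by
  obtain ⟨C, hC⟩ : ∃ C, ∀ u, |f u| ≤ C := by
    obtain ⟨C, hC⟩ := isCompact_univ.exists_bound_of_continuousOn hf.continuousOn
    exact ⟨C, fun u => hC u (Set.mem_univ u)⟩
  have hmod : ∀ η > 0, ∃ ρ > 0, ∀ u v, dist u v ≤ ρ → f u ≤ f v + η := by
    intro η hη
    obtain ⟨ρ, hρ, h⟩ := Metric.uniformContinuous_iff.1
      (CompactSpace.uniformContinuous_of_continuous hf) η hη
    refine ⟨ρ / 2, half_pos hρ, fun u v huv => ?_⟩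
    have := (abs_lt.1 (h (huv.trans_lt (half_lt_self hρ)))).2
    linarith
  unfold Pres
  set p : ℝ → ℝ := fun ε => limsup (fun n : ℕ => Real.log (spanPress T f n ε) / n) atTop
  set E : ℝ → Set ℝ := fun ε => { r : ℝ | ∃ δ : ℝ, 0 < δ ∧ ∃ α : ℝ, 0 < α ∧
    r = limsup (fun n : ℕ => Real.log (FKPOsp T f n ε α δ (N δ)) / n) atTop }
  have hEne : ∀ ε, (E ε).Nonempty := fun ε => ⟨_, 1, one_pos, 1, one_pos, rfl⟩
  have hElb : ∀ ε > 0, ∀ r ∈ E ε, -C ≤ r := by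
    rintro ε hε r ⟨δ, hδ, α, hα, rfl⟩
    obtain ⟨R, hR⟩ := exists_FKPOsp_le_exp (T := T) hC hε α δ (N δ)
    exact le_limsup_log_div (exp_le_FKPOsp hC hε hα hδ (hN δ hδ)) hR
  have hpE : ∀ ε > 0, ∀ ω, (∀ u v, dist u v ≤ ε → f u ≤ f v + ω) →
      p (2 * ε) ≤ sInf (E ε) + ω := by
    intro ε hε ω hω
    rw [← sub_le_iff_le_add]
    refine le_csInf (hEne ε) ?_
    rintro r ⟨δ, hδ, α, hα, rfl⟩
    rw [sub_le_iff_le_add]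
    exact limsup_spanPress_le hC hε hα hδ (hN δ hδ) hω
  have hEp : ∀ ρ > 0, ∀ ε, 2 * (2 * ρ) < ε → ∀ ω, (∀ u v, dist u v ≤ 2 * ρ → f u ≤ f v + ω) →
      sInf (E ε) ≤ p ρ + ω := by
    intro ρ hρ ε hρε ω hω
    refine le_of_forall_pos_le_add fun η hη => ?_
    obtain ⟨δ, hδ, α, hα, hle⟩ := exists_limsup_FKPOsp_le hT hC hN hρ hρε hω
      (η := η / 4) (by positivity)
    refine (csInf_le ⟨-C, hElb ε (by linarith)⟩ ⟨δ, hδ, α, hα, rfl⟩).trans (hle.trans_eq ?_)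
    ring
  rw [limsup_eq, limsup_eq]
  refine Real.sInf_eq_of_forall_add_mem ⟨-C, fun a ha => ?_⟩ ⟨-C, fun a ha => ?_⟩
    (fun a ha η hη => ?_) fun a ha η hη => ?_
  · rw [Set.mem_ofPred_eq] at ha
    obtain ⟨ε, hle, hε⟩ := (ha.and self_mem_nhdsWithin).exists
    exact (le_csInf (hEne ε) (hElb ε hε)).trans hle
  · rw [Set.mem_ofPred_eq] at ha
    obtain ⟨ε, hle, hε⟩ := (ha.and self_mem_nhdsWithin).exists
    obtain ⟨R, hR⟩ := exists_spanPress_le_exp (T := T) hC hε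
    exact (le_limsup_log_div (exp_le_spanPress hC hε) hR).trans hle
  · obtain ⟨ρ, hρ, hω⟩ := hmod η hη
    filter_upwards [eventually_comp_div_nhdsGT_zero ha two_pos, self_mem_nhdsWithin,
      eventually_nhdsWithin_of_eventually_nhds (eventually_lt_nhds hρ)] with ε hle hε hερ
    have hε' : 0 < ε := hε
    have := hpE (ε / 2) (by positivity) η fun u v huv => hω u v (by linarith)
    rw [mul_div_cancel₀ ε (two_ne_zero' ℝ)] at this
    linarith
  · obtain ⟨ρ, hρ, hω⟩ := hmod η hη
    filter_upwards [eventually_comp_div_nhdsGT_zero ha (c := 5) (by norm_num),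
      self_mem_nhdsWithin,
      eventually_nhdsWithin_of_eventually_nhds (eventually_lt_nhds hρ)] with ε hle hε hερ
    have hε' : 0 < ε := hε
    have := hEp (ε / 5) (by positivity) ε (by linarith) η fun u v huv => hω u v (by linarith)
    linarith

/-- the variant of the FK-pseudo-orbit pressure, with the limsup over δ
replaced by an infimum over δ > 0, also equals the classical topological pressure. -/
theorem PFKPO_inf_delta_eq_pressure [MetricSpace X] [CompactSpace X] (T : X → X)
    (hT : Continuous T) (f : X → ℝ) (hf : Continuous f)
    (N : ℝ → ℕ) (hN : ∀ δ : ℝ, 0 < δ → 1 ≤ N δ) :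
    limsup (fun ε : ℝ =>
        sInf { r : ℝ | ∃ δ : ℝ, 0 < δ ∧ ∃ α : ℝ, 0 < α ∧
            r = limsup (fun n : ℕ => Real.log (FKPOsp T f n ε α δ (N δ)) / n) atTop })
      (nhdsWithin 0 (Set.Ioi 0)) = Pres T f := by
  rcases isEmpty_or_nonempty X with hX | hX
  · have hFK : ∀ n ε α δ M, FKPOsp T f n ε α δ M = 0 := by
      intro n ε α δ M
      refine le_antisymm ?_ (Real.sInf_nonneg ?_)
      · simpa using FKPOsp_le (T := T) (f := f) (n := n) (ε := ε) (α := α) (δ := δ) (N := M)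
          (F := ∅) (by simp) fun x => isEmptyElim (x 0)
      · rintro r ⟨F, -, -, rfl⟩
        positivity
    have hspan : ∀ n ε, spanPress T f n ε = 0 := by
      intro n ε
      refine le_antisymm ?_ (Real.sInf_nonneg ?_)
      · simpa using spanPress_le (T := T) (f := f) (n := n) (ε := ε) (F := ∅) isEmptyElim
      · rintro r ⟨F, -, rfl⟩
        positivity
    have hset : {r : ℝ | ∃ δ : ℝ, 0 < δ ∧ ∃ α : ℝ, 0 < α ∧ r = 0} = {0} := by
      ext r
      exact ⟨fun ⟨_, _, _, _, h⟩ => h, fun h => ⟨1, one_pos, 1, one_pos, h⟩⟩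
    simp only [Pres, hFK, hspan, Real.log_zero, zero_div, limsup_const, hset, csInf_singleton]
  · exact limsup_sInf_FKPOsp_eq_Pres_of_nonempty hT hf hN
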